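/- Let n ≥ 1 and let G be a non-elementary discrete subgroup of PU(1,n), i.e., its Chen–Greenberg limit set Λ_CG(G) contains more than two points. Then Λ_CG(G) is the unique minimal nonempty closed G-invariant subset of ∂𝐇ⁿ_ℂ: every nonempty closed G-invariant subset S of ∂𝐇ⁿ_ℂ contains Λ_CG(G). -/

import Mathlib

open Filter Topology Matrix

noncomputable section

abbrev Vec (n : ℕ) := Fin (n + 1) → ℂ
abbrev Mat (n : ℕ) := Matrix (Fin (n + 1)) (Fin (n + 1)) ℂ
abbrev Pn (n : ℕ) := Projectivization ℂ (Vec n)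

instance (n : ℕ) : TopologicalSpace (Pn n) :=
  inferInstanceAs (TopologicalSpace (Quotient (projectivizationSetoid ℂ (Vec n))))

def herm (n : ℕ) (u v : Vec n) : ℂ :=
  -(u 0 * (starRingEnd ℂ) (v 0)) + ∑ j : Fin n, u j.succ * (starRingEnd ℂ) (v j.succ)

def Hball (n : ℕ) : Set (Pn n) :=
  {p | ∃ v : Vec n, ∃ hv : v ≠ 0, p = Projectivization.mk ℂ v hv ∧ (herm n v v).re < 0}

def Hbdry (n : ℕ) : Set (Pn n) :=
  {p | ∃ v : Vec n, ∃ hv : v ≠ 0, p = Projectivization.mk ℂ v hv ∧ herm n v v = 0}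

abbrev GLn (n : ℕ) := Matrix.GeneralLinearGroup (Fin (n + 1)) ℂ
abbrev PGLn (n : ℕ) := GLn n ⧸ Subgroup.center (GLn n)

lemma glInj {n : ℕ} (A : GLn n) : Function.Injective (Matrix.mulVecLin (A : Mat n)) := by
  intro x y h
  simp only [Matrix.mulVecLin_apply] at h
  have h2 : ((A⁻¹ : GLn n) : Mat n) *ᵥ ((A : Mat n) *ᵥ x)
      = ((A⁻¹ : GLn n) : Mat n) *ᵥ ((A : Mat n) *ᵥ y) := by rw [h]
  rwa [Matrix.mulVec_mulVec, Matrix.mulVec_mulVec, Units.inv_mul, Matrix.one_mulVec,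
    Matrix.one_mulVec] at h2

def actGL {n : ℕ} (A : GLn n) : Pn n → Pn n :=
  Projectivization.map (Matrix.mulVecLin (A : Mat n)) (glInj A)

def act {n : ℕ} (g : PGLn n) : Pn n → Pn n := actGL (Quotient.out g)

-- part 2 --

/-- The subset `U(1,n)` of `GL(n+1,ℂ)`: matrices preserving the Hermitian form. -/
def unitaryGL (n : ℕ) : Set (GLn n) :=
  {A | ∀ u v : Vec n, herm n ((A : Mat n) *ᵥ u) ((A : Mat n) *ᵥ v) = herm n u v}

/-- `PU(1,n)`, the image of `U(1,n)` in `PGL(n+1,ℂ)`. -/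
def PUset (n : ℕ) : Set (PGLn n) := (QuotientGroup.mk : GLn n → PGLn n) '' unitaryGL n

/-- The center of the ball `𝐇ⁿ_ℂ`, namely the image of `(1,0,…,0)`. -/
def basePt (n : ℕ) : Pn n :=
  Projectivization.mk ℂ (Pi.single 0 1) (by
    intro h
    have := congrFun h 0
    simp [Pi.single_eq_same] at this)

lemma basePt_mem_Hball (n : ℕ) : basePt n ∈ Hball n := by
  refine ⟨Pi.single 0 1, _, rfl, ?_⟩
  have : herm n (Pi.single 0 1) (Pi.single 0 1) = -1 := by
    simp [herm, Pi.single_eq_same, Pi.single_eq_of_ne (Fin.succ_ne_zero _)]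
  rw [this]
  norm_num

/-- The set of accumulation points of the orbit `G • x` in `ℙⁿ_ℂ`: limits of
`g_m • x` along sequences of pairwise distinct elements of `G`. -/
def accPts {n : ℕ} (G : Subgroup (PGLn n)) (x : Pn n) : Set (Pn n) :=
  {z | ∃ g : ℕ → G, Function.Injective g ∧
    Tendsto (fun m => act (g m : PGLn n) x) atTop (𝓝 z)}

/-- The Chen–Greenberg limit set of `G`. -/
def LambdaCG {n : ℕ} (G : Subgroup (PGLn n)) : Set (Pn n) := accPts G (basePt n)

/-- Uniform convergence on `K` of a sequence of self-maps of `ℙⁿ_ℂ` to `F`, expressed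
via open neighborhoods of the diagonal.  Since `ℙⁿ_ℂ` is compact Hausdorff, this is
equivalent to uniform convergence on `K` with respect to any metric inducing its
topology. -/
def UnifConvOn {n : ℕ} (f : ℕ → Pn n → Pn n) (F : Pn n → Pn n) (K : Set (Pn n)) : Prop :=
  ∀ W : Set (Pn n × Pn n), IsOpen W → (∀ y, (y, y) ∈ W) →
    ∀ᶠ m in atTop, ∀ x ∈ K, (F x, f m x) ∈ W

/-- Uniform convergence on all compact subsets of `S`. -/
def UnifConvOnCompacts {n : ℕ} (f : ℕ → Pn n → Pn n) (F : Pn n → Pn n)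
    (S : Set (Pn n)) : Prop :=
  ∀ K ⊆ S, IsCompact K → UnifConvOn f F K

/-- The equicontinuity region of a subgroup `G ≤ PGL(n+1,ℂ)`: points having an open
neighborhood `U` on which every sequence in `G` has a subsequence converging uniformly
on compact subsets of `U`. -/
def eqRegion {n : ℕ} (G : Subgroup (PGLn n)) : Set (Pn n) :=
  {z | ∃ U : Set (Pn n), IsOpen U ∧ z ∈ U ∧
    ∀ g : ℕ → G, ∃ φ : ℕ → ℕ, StrictMono φ ∧ ∃ F : Pn n → Pn n,
      UnifConvOnCompacts (fun m => act (g (φ m) : PGLn n)) F U}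

/-- The equicontinuity region of the family of maps `{f m : m ∈ ℕ}`. -/
def eqRegionFam {n : ℕ} (f : ℕ → Pn n → Pn n) : Set (Pn n) :=
  {z | ∃ U : Set (Pn n), IsOpen U ∧ z ∈ U ∧
    ∀ s : ℕ → ℕ, ∃ φ : ℕ → ℕ, StrictMono φ ∧ ∃ F : Pn n → Pn n,
      UnifConvOnCompacts (fun k => f (s (φ k))) F U}

/-- The projectivization of a linear subspace `W ⊆ ℂ^{n+1}`, as a subset of `ℙⁿ_ℂ`. -/
def projSet {n : ℕ} (W : Submodule ℂ (Vec n)) : Set (Pn n) := {p | p.rep ∈ W}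

/-- A complex projective hyperplane: the projectivization of an `n`-dimensional
subspace of `ℂ^{n+1}`. -/
def IsProjHyperplane {n : ℕ} (S : Set (Pn n)) : Prop :=
  ∃ W : Submodule ℂ (Vec n), Module.finrank ℂ W = n ∧ S = projSet W

/-- A complex projective line: the projectivization of a `2`-dimensional subspace. -/
def IsProjLine {n : ℕ} (S : Set (Pn n)) : Prop :=
  ∃ W : Submodule ℂ (Vec n), Module.finrank ℂ W = 2 ∧ S = projSet W

/-- The kernel in `ℙⁿ_ℂ` of the quasi-projective map induced by the nonzero matrix `M`. -/
def qKer {n : ℕ} (M : Mat n) : Set (Pn n) := projSet (LinearMap.ker (Matrix.mulVecLin M))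

/-- The image in `ℙⁿ_ℂ` of the quasi-projective map induced by the nonzero matrix `M`. -/
def qIm {n : ℕ} (M : Mat n) : Set (Pn n) := projSet (LinearMap.range (Matrix.mulVecLin M))

/-- The quasi-projective map `ℙⁿ_ℂ ∖ Ker(M) → ℙⁿ_ℂ` induced by the nonzero matrix `M`
(extended to all of `ℙⁿ_ℂ` by the identity on `Ker(M)`, where it is irrelevant). -/
def qMap {n : ℕ} (M : Mat n) : Pn n → Pn n := fun p =>
  if h : M *ᵥ p.rep ≠ 0 then Projectivization.mk ℂ (M *ᵥ p.rep) h else p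

/-- Convergence of a sequence of transformations of `ℙⁿ_ℂ` to the quasi-projective map
induced by `M`, in the sense of quasi-projective transformations: uniform convergence
on compact subsets of `ℙⁿ_ℂ ∖ Ker(M)`. -/
def QPConv {n : ℕ} (f : ℕ → Pn n → Pn n) (M : Mat n) : Prop :=
  UnifConvOnCompacts f (qMap M) (qKer M)ᶜ

/-- The special linear group `SL(n+1,ℂ)`. -/
abbrev SLn (n : ℕ) := Matrix.SpecialLinearGroup (Fin (n + 1)) ℂ

/-- The projective special linear group `PSL(n+1,ℂ) = SL(n+1,ℂ)/center`. -/
abbrev PSLn (n : ℕ) := SLn n ⧸ Subgroup.center (SLn n)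

/-- The projective transformation induced by an element of `SL(n+1,ℂ)`. -/
def actSL {n : ℕ} (A : SLn n) : Pn n → Pn n := actGL (Matrix.SpecialLinearGroup.toGL A)

/-- The projective transformation induced by an element of `PSL(n+1,ℂ)` (via an
arbitrary representative; all representatives induce the same transformation). -/
def actPSL {n : ℕ} (g : PSLn n) : Pn n → Pn n := actSL (Quotient.out g)

/-- The projective hyperplane tangent to `∂𝐇ⁿ_ℂ` at `p`: the projectivization of the
Hermitian orthogonal complement of a lift of `p`. -/
def tangentAt {n : ℕ} (p : Pn n) : Set (Pn n) := {q | herm n q.rep p.rep = 0}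

end

section HermitianForm

variable {n : ℕ}

lemma herm_smul_left (c : ℂ) (u v : Vec n) : herm n (c • u) v = c * herm n u v := by
  simp only [herm, Pi.smul_apply, smul_eq_mul, mul_add, Finset.mul_sum, mul_assoc, mul_neg]

lemma herm_conj (u v : Vec n) : (starRingEnd ℂ) (herm n u v) = herm n v u := by
  simp only [herm, map_add, map_neg, map_mul, map_sum, Complex.conj_conj, mul_comm]

lemma herm_smul_right (c : ℂ) (u v : Vec n) :
    herm n u (c • v) = (starRingEnd ℂ) c * herm n u v := by
  rw [← herm_conj, herm_smul_left, map_mul, herm_conj]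

lemma herm_add_left (u v w : Vec n) : herm n (u + v) w = herm n u w + herm n v w := by
  simp only [herm, Pi.add_apply, add_mul, Finset.sum_add_distrib]
  ring

lemma herm_sub_left (u v w : Vec n) : herm n (u - v) w = herm n u w - herm n v w := by
  rw [sub_eq_add_neg, ← neg_one_smul ℂ v, herm_add_left, herm_smul_left]
  ring

lemma herm_sub_right (u v w : Vec n) : herm n u (v - w) = herm n u v - herm n u w := by
  rw [← herm_conj, herm_sub_left, map_sub, herm_conj, herm_conj]

lemma herm_eq_zero_symm {u v : Vec n} (h : herm n u v = 0) : herm n v u = 0 := by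
  rw [← herm_conj, h, map_zero]

lemma herm_self (v : Vec n) :
    herm n v v = ((-‖v 0‖ ^ 2 + ∑ j : Fin n, ‖v j.succ‖ ^ 2 : ℝ) : ℂ) := by
  simp only [herm, Complex.mul_conj, Complex.normSq_eq_norm_sq]
  push_cast
  rfl

lemma herm_self_re_nonneg_of_zero {v : Vec n} (h0 : v 0 = 0) : 0 ≤ (herm n v v).re := by
  rw [herm_self, Complex.ofReal_re, h0]
  simp only [norm_zero, ne_eq, OfNat.ofNat_ne_zero, not_false_eq_true, zero_pow, neg_zero, zero_add]
  positivity

lemma eq_zero_of_herm_self_eq_zero {v : Vec n} (h0 : v 0 = 0) (h : herm n v v = 0) : v = 0 := by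
  rw [herm_self, Complex.ofReal_eq_zero, h0] at h
  simp only [norm_zero, ne_eq, OfNat.ofNat_ne_zero, not_false_eq_true, zero_pow, neg_zero,
    zero_add] at h
  rw [Finset.sum_eq_zero_iff_of_nonneg (fun i _ => by positivity)] at h
  ext i
  refine Fin.cases h0 (fun j => ?_) i
  simpa using h j (Finset.mem_univ j)

/-- Orthogonal null vectors are proportional. -/
lemma exists_smul_eq_of_herm_eq_zero {u v : Vec n} (hv : v ≠ 0) (huu : herm n u u = 0)
    (hvv : herm n v v = 0) (huv : herm n u v = 0) : ∃ c : ℂ, c • v = u := by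
  have hv0 : v 0 ≠ 0 := fun h => hv (eq_zero_of_herm_self_eq_zero h hvv)
  refine ⟨u 0 / v 0, (sub_eq_zero.mp (eq_zero_of_herm_self_eq_zero ?_ ?_)).symm⟩
  · simp [hv0]
  · simp [herm_sub_left, herm_sub_right, herm_smul_left, herm_smul_right, huu, hvv, huv,
      herm_eq_zero_symm huv]

lemma herm_ne_zero_of_neg_of_null {u v : Vec n} (huu : (herm n u u).re < 0) (hv : v ≠ 0)
    (hvv : herm n v v = 0) : herm n u v ≠ 0 := by
  intro huv
  have hv0 : v 0 ≠ 0 := fun h => hv (eq_zero_of_herm_self_eq_zero h hvv)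
  have h := herm_self_re_nonneg_of_zero (v := u - (u 0 / v 0) • v) (by simp [hv0])
  simp only [herm_sub_left, herm_sub_right, herm_smul_left, herm_smul_right, hvv, huv,
    herm_eq_zero_symm huv, mul_zero, sub_zero] at h
  exact absurd huu (not_lt.mpr h)

end HermitianForm

section UnitaryMatrices

variable {n : ℕ}

/-- The Gram matrix of the Hermitian form. -/
def gramMat (n : ℕ) : Mat n := Matrix.diagonal (Fin.cons (-1) fun _ => 1)

lemma herm_eq_star_dotProduct (u v : Vec n) : herm n u v = star v ⬝ᵥ (gramMat n *ᵥ u) := by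
  simp only [herm, gramMat, dotProduct, Matrix.mulVec_diagonal, Fin.sum_univ_succ, Fin.cons_zero,
    Fin.cons_succ, Pi.star_apply, RCLike.star_def]
  congr 1
  · ring
  · exact Finset.sum_congr rfl fun _ _ => by ring

@[simp] lemma gramMat_mulVec_zero (v : Vec n) : (gramMat n *ᵥ v) 0 = -v 0 := by
  simp [gramMat, Matrix.mulVec_diagonal]

@[simp] lemma gramMat_mulVec_succ (v : Vec n) (j : Fin n) :
    (gramMat n *ᵥ v) j.succ = v j.succ := by
  simp [gramMat, Matrix.mulVec_diagonal]

lemma gramMat_mul_self : gramMat n * gramMat n = 1 := by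
  rw [gramMat, Matrix.diagonal_mul_diagonal, ← Matrix.diagonal_one]
  congr 1
  ext i
  refine Fin.cases ?_ (fun j => ?_) i <;> simp

lemma conjTranspose_mul_gramMat_mul {A : GLn n} (hA : A ∈ unitaryGL n) :
    (A : Mat n)ᴴ * gramMat n * (A : Mat n) = gramMat n := by
  ext i j
  have h := hA (Pi.single j 1) (Pi.single i 1)
  rw [herm_eq_star_dotProduct, herm_eq_star_dotProduct, Matrix.star_mulVec,
    ← Matrix.dotProduct_mulVec, Matrix.mulVec_mulVec, Matrix.mulVec_mulVec] at h
  have key : ∀ M : Mat n, star (Pi.single i 1 : Vec n) ⬝ᵥ (M *ᵥ Pi.single j 1) = M i j := by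
    intro M
    simp
  rwa [key, key] at h

lemma inv_eq_gramMat_mul {A : GLn n} (hA : A ∈ unitaryGL n) :
    ((A⁻¹ : GLn n) : Mat n) = gramMat n * (A : Mat n)ᴴ * gramMat n := by
  have h : (gramMat n * (A : Mat n)ᴴ * gramMat n) * (A : Mat n) = 1 := by
    rw [Matrix.mul_assoc, Matrix.mul_assoc, ← Matrix.mul_assoc _ (gramMat n),
      conjTranspose_mul_gramMat_mul hA, gramMat_mul_self]
  exact (Units.inv_eq_of_mul_eq_one_left h)

lemma mul_gramMat_mul_conjTranspose {A : GLn n} (hA : A ∈ unitaryGL n) :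
    (A : Mat n) * gramMat n * (A : Mat n)ᴴ = gramMat n := by
  have h : (A : Mat n) * ((A⁻¹ : GLn n) : Mat n) = 1 := A.mul_inv
  rw [inv_eq_gramMat_mul hA] at h
  calc (A : Mat n) * gramMat n * (A : Mat n)ᴴ
      = (A : Mat n) * (gramMat n * (A : Mat n)ᴴ * gramMat n) * gramMat n := by
        simp only [Matrix.mul_assoc, gramMat_mul_self, Matrix.mul_one]
    _ = gramMat n := by rw [h, Matrix.one_mul]

lemma unitaryGL_mul {A B : GLn n} (hA : A ∈ unitaryGL n) (hB : B ∈ unitaryGL n) :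
    A * B ∈ unitaryGL n := by
  intro u v
  rw [Units.val_mul, ← Matrix.mulVec_mulVec, ← Matrix.mulVec_mulVec, hA, hB]

lemma mul_inv_mulVec (A : GLn n) (v : Vec n) :
    (A : Mat n) *ᵥ (((A⁻¹ : GLn n) : Mat n) *ᵥ v) = v := by
  rw [Matrix.mulVec_mulVec, Units.mul_inv, Matrix.one_mulVec]

lemma inv_mul_mulVec (A : GLn n) (v : Vec n) :
    ((A⁻¹ : GLn n) : Mat n) *ᵥ ((A : Mat n) *ᵥ v) = v := by
  rw [Matrix.mulVec_mulVec, Units.inv_mul, Matrix.one_mulVec]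

lemma unitaryGL_inv {A : GLn n} (hA : A ∈ unitaryGL n) : A⁻¹ ∈ unitaryGL n := by
  intro u v
  rw [← hA, mul_inv_mulVec, mul_inv_mulVec]

lemma mulVec_ne_zero (A : GLn n) {v : Vec n} (hv : v ≠ 0) : (A : Mat n) *ᵥ v ≠ 0 := by
  intro h
  rw [← inv_mul_mulVec A v, h, Matrix.mulVec_zero] at hv
  exact hv rfl

lemma herm_col_col (M : Mat n) (i j : Fin (n + 1)) :
    herm n (fun k => M k j) (fun k => M k i) = (Mᴴ * gramMat n * M) i j := by
  rw [herm_eq_star_dotProduct, Matrix.mul_assoc, Matrix.mul_apply]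
  rfl

lemma herm_row_row (M : Mat n) (i j : Fin (n + 1)) :
    herm n (fun k => M i k) (fun k => M j k) = (M * gramMat n * Mᴴ) i j := by
  rw [← herm_conj, ← Matrix.conjTranspose_conjTranspose M, herm_eq_star_dotProduct]
  rw [Matrix.mul_apply]
  simp only [gramMat, Matrix.mul_diagonal, dotProduct, Matrix.mulVec_diagonal, map_sum]
  refine Finset.sum_congr rfl fun k _ => ?_
  refine Fin.cases ?_ (fun l => ?_) k <;> simp 

/-- The entries of a matrix in `U(1,n)` are bounded by the upper left one. -/
lemma norm_entry_le {A : GLn n} (hA : A ∈ unitaryGL n) (i j : Fin (n + 1)) :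
    ‖(A : Mat n) i j‖ ≤ ‖(A : Mat n) 0 0‖ := by
  have h00 : gramMat n 0 0 = -1 := by simp [gramMat]
  have hrow := herm_row_row (A : Mat n) 0 0
  rw [mul_gramMat_mul_conjTranspose hA, herm_self, h00] at hrow
  have hrow' : -‖(A : Mat n) 0 0‖ ^ 2 + ∑ k : Fin n, ‖(A : Mat n) 0 k.succ‖ ^ 2 = -1 := by
    exact_mod_cast hrow
  have hcol := herm_col_col (A : Mat n) j j
  rw [conjTranspose_mul_gramMat_mul hA, herm_self] at hcol
  rw [← pow_le_pow_iff_left₀ (norm_nonneg _) (norm_nonneg _) two_ne_zero]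
  revert hcol
  refine Fin.cases ?_ (fun l => ?_) j
  · rw [h00]
    intro hcol
    have hcol' : -‖(A : Mat n) 0 0‖ ^ 2 + ∑ k : Fin n, ‖(A : Mat n) k.succ 0‖ ^ 2 = -1 := by
      exact_mod_cast hcol
    refine Fin.cases le_rfl (fun k => ?_) i
    have := Finset.single_le_sum (f := fun k : Fin n => ‖(A : Mat n) k.succ 0‖ ^ 2)
      (fun _ _ => by positivity) (Finset.mem_univ k)
    linarith
  · have h11 : gramMat n l.succ l.succ = 1 := by simp [gramMat]
    rw [h11]
    intro hcol
    have hcol' : -‖(A : Mat n) 0 l.succ‖ ^ 2 + ∑ k : Fin n, ‖(A : Mat n) k.succ l.succ‖ ^ 2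
        = 1 := by exact_mod_cast hcol
    have hl := Finset.single_le_sum (f := fun k : Fin n => ‖(A : Mat n) 0 k.succ‖ ^ 2)
      (fun _ _ => by positivity) (Finset.mem_univ l)
    refine Fin.cases (by linarith) (fun k => ?_) i
    have := Finset.single_le_sum (f := fun k : Fin n => ‖(A : Mat n) k.succ l.succ‖ ^ 2)
      (fun _ _ => by positivity) (Finset.mem_univ k)
    linarith

end UnitaryMatrices

section Sequences

variable {n : ℕ}

lemma exists_tendsto_subseq_of_entries_bounded (M : ℕ → Mat n) (R : ℝ)
    (h : ∀ m i j, ‖M m i j‖ ≤ R) :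
    ∃ φ : ℕ → ℕ, StrictMono φ ∧ ∃ B : Mat n, Tendsto (fun m => M (φ m)) atTop (𝓝 B) := by
  have hK : IsCompact (Set.pi Set.univ fun _ : Fin (n + 1) =>
      Set.pi Set.univ fun _ : Fin (n + 1) => Metric.closedBall (0 : ℂ) R) :=
    isCompact_univ_pi fun _ => isCompact_univ_pi fun _ => isCompact_closedBall 0 R
  obtain ⟨B, -, φ, hφ, hB⟩ := IsCompact.tendsto_subseq
    (X := Fin (n + 1) → Fin (n + 1) → ℂ) hK (x := M)
    fun m i _ j _ => by simpa using h m i j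
  exact ⟨φ, hφ, B, hB⟩

lemma tendsto_units {X : Type*} {l : Filter X} {M : Type*} [Monoid M] [TopologicalSpace M]
    {u : X → Mˣ} {v : Mˣ} (h : Tendsto (fun x => (u x : M)) l (𝓝 (v : M)))
    (h' : Tendsto (fun x => ((u x)⁻¹.val : M)) l (𝓝 (v⁻¹.val : M))) : Tendsto u l (𝓝 v) := by
  rw [Units.isInducing_embedProduct.tendsto_nhds_iff]
  exact h.prodMk_nhds ((MulOpposite.continuous_op.tendsto _).comp h')

/-- A sequence of pairwise distinct elements of a discrete subgroup of `PU(1,n)` leaves every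
compact set. -/
lemma tendsto_norm_zero_zero_atTop {G : Subgroup (PGLn n)} (hdisc : DiscreteTopology ↥G)
    {g : ℕ → G} (hg : Function.Injective g) {A : ℕ → GLn n} (hA : ∀ m, A m ∈ unitaryGL n)
    (hAg : ∀ m, (QuotientGroup.mk (A m) : PGLn n) = g m) :
    Tendsto (fun m => ‖(A m : Mat n) 0 0‖) atTop atTop := by
  by_contra hcon
  rw [tendsto_atTop] at hcon
  push Not at hcon
  obtain ⟨R, hR⟩ := hcon
  have hR' : ∃ᶠ m in atTop, ‖(A m : Mat n) 0 0‖ < R := by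
    simpa only [not_eventually, not_le] using hR
  obtain ⟨φ, hφ, hφR⟩ := extraction_of_frequently_atTop hR'
  obtain ⟨ψ, hψ, B, hB⟩ := exists_tendsto_subseq_of_entries_bounded
    (fun m => (A (φ m) : Mat n)) R
    fun m i j => (norm_entry_le (hA _) i j).trans (hφR m).le
  set C : ℕ → GLn n := fun m => A (φ (ψ m)) with hC
  have hCB : Tendsto (fun m => (C m : Mat n)) atTop (𝓝 B) := hB
  have hCB' : Tendsto (fun m => (C (m + 1) : Mat n)) atTop (𝓝 B) :=
    hCB.comp (tendsto_add_atTop_nat 1)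
  have hCt : Tendsto (fun m => (C m : Mat n)ᴴ) atTop (𝓝 Bᴴ) :=
    ((continuous_id.matrix_conjTranspose).tendsto B).comp hCB
  have hCt' : Tendsto (fun m => (C (m + 1) : Mat n)ᴴ) atTop (𝓝 Bᴴ) :=
    hCt.comp (tendsto_add_atTop_nat 1)
  have hBB : Bᴴ * gramMat n * B = gramMat n := by
    refine tendsto_nhds_unique ((hCt.mul_const (gramMat n)).mul hCB) ?_
    simp only [hC, conjTranspose_mul_gramMat_mul (hA _)]
    exact tendsto_const_nhds
  have hone : gramMat n * Bᴴ * gramMat n * B = 1 := by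
    rw [Matrix.mul_assoc, Matrix.mul_assoc, ← Matrix.mul_assoc _ (gramMat n), hBB,
      gramMat_mul_self]
  have hlim : Tendsto (fun m => (C m)⁻¹ * C (m + 1)) atTop (𝓝 1) := by
    refine tendsto_units ?_ ?_
    · simp only [Units.val_mul, hC, inv_eq_gramMat_mul (hA _), Units.val_one]
      rw [← hone]
      exact ((hCt.const_mul _).mul_const _).mul hCB'
    · simp only [_root_.mul_inv_rev, inv_inv, Units.val_mul, hC, inv_eq_gramMat_mul (hA _),
        inv_one, Units.val_one]
      rw [← hone]
      exact ((hCt'.const_mul _).mul_const _).mul hCB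
  have hlimG : Tendsto (fun m => (g (φ (ψ m)))⁻¹ * g (φ (ψ (m + 1)))) atTop (𝓝 1) := by
    rw [tendsto_subtype_rng]
    have := (QuotientGroup.continuous_mk (N := Subgroup.center (GLn n))).tendsto 1 |>.comp hlim
    refine this.congr fun m => ?_
    simp only [Function.comp_apply, QuotientGroup.mk_mul, QuotientGroup.mk_inv, hC, hAg]
    rfl
  have hev := hlimG.eventually ((isOpen_discrete ({1} : Set G)).mem_nhds rfl)
  obtain ⟨m, hm⟩ := hev.exists
  have heq : g (φ (ψ m)) = g (φ (ψ (m + 1))) := inv_mul_eq_one.mp hm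
  have := (hφ.comp hψ).injective (hg heq)
  omega

/-- After rescaling, a sequence of pairwise distinct elements of a discrete subgroup of `PU(1,n)`
subconverges to a matrix of rank one with null kernel direction and null image. -/
lemma exists_subseq_tendsto_rank_one {G : Subgroup (PGLn n)} (hdisc : DiscreteTopology ↥G)
    {g : ℕ → G} (hg : Function.Injective g) {A : ℕ → GLn n} (hA : ∀ m, A m ∈ unitaryGL n)
    (hAg : ∀ m, (QuotientGroup.mk (A m) : PGLn n) = g m) :
    ∃ φ : ℕ → ℕ, StrictMono φ ∧ ∃ (s : ℕ → ℂ) (a b : Vec n), (∀ m, s m ≠ 0) ∧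
      Tendsto s atTop (𝓝 0) ∧ a ≠ 0 ∧ b ≠ 0 ∧ herm n a a = 0 ∧ herm n b b = 0 ∧
      ∀ x : Vec n, Tendsto (fun m => s m • ((A (φ m) : Mat n) *ᵥ x)) atTop
        (𝓝 (herm n x b • a)) := by
  have htop := tendsto_norm_zero_zero_atTop hdisc hg hA hAg
  have hne : ∀ m, (A m : Mat n) 0 0 ≠ 0 := by
    intro m h
    have h1 := herm_col_col (A m : Mat n) 0 0
    rw [conjTranspose_mul_gramMat_mul (hA m)] at h1
    have h2 := herm_self_re_nonneg_of_zero (v := fun k => (A m : Mat n) k 0) h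
    rw [h1] at h2
    simp only [gramMat, diagonal_apply_eq, Fin.cons_zero, Complex.neg_re, Complex.one_re] at h2
    linarith
  set t : ℕ → ℂ := fun m => ((A m : Mat n) 0 0)⁻¹ with ht
  have ht0 : Tendsto t atTop (𝓝 0) := by
    rw [tendsto_zero_iff_norm_tendsto_zero]
    simp only [ht, norm_inv]
    exact htop.inv_tendsto_atTop
  obtain ⟨φ, hφ, B, hB⟩ := exists_tendsto_subseq_of_entries_bounded
    (fun m => t m • (A m : Mat n)) 1 (by
      intro m i j
      simp only [ht, Matrix.smul_apply, smul_eq_mul, norm_mul, norm_inv]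
      rw [inv_mul_le_one₀ (norm_pos_iff.mpr (hne m))]
      exact norm_entry_le (hA m) i j)
  have htφ : Tendsto (fun m => t (φ m)) atTop (𝓝 0) := ht0.comp hφ.tendsto_atTop
  have hBt : Tendsto (fun m => (t (φ m) • (A (φ m) : Mat n))ᴴ) atTop (𝓝 Bᴴ) :=
    ((continuous_id.matrix_conjTranspose).tendsto B).comp hB
  have hstar : Tendsto (fun m => star (t (φ m))) atTop (𝓝 0) := by
    rw [← star_zero]
    exact (continuous_star.tendsto (0 : ℂ)).comp htφ
  have hsq : Tendsto (fun m => (t (φ m) * star (t (φ m))) • gramMat n) atTop (𝓝 0) := by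
    have := (htφ.mul hstar).smul_const (gramMat n)
    simpa using this
  have hcol : Bᴴ * gramMat n * B = 0 := by
    refine tendsto_nhds_unique ((hBt.mul_const (gramMat n)).mul hB) (hsq.congr fun m => ?_)
    refine (congrArg _ (conjTranspose_mul_gramMat_mul (hA (φ m))).symm).trans ?_
    simp only [conjTranspose_smul, Matrix.smul_mul, Matrix.mul_smul, smul_smul]
  have hrow : B * gramMat n * Bᴴ = 0 := by
    refine tendsto_nhds_unique ((hB.mul_const (gramMat n)).mul hBt) (hsq.congr fun m => ?_)
    refine (congrArg _ (mul_gramMat_mul_conjTranspose (hA (φ m))).symm).trans ?_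
    simp only [conjTranspose_smul, Matrix.smul_mul, Matrix.mul_smul, smul_smul, mul_comm]
  have hB00 : B 0 0 = 1 := by
    refine tendsto_nhds_unique
      (((continuous_id.matrix_elem 0 0).tendsto B).comp hB) (tendsto_const_nhds.congr fun m => ?_)
    simp only [ht, Function.comp_apply, id_eq, Matrix.smul_apply, smul_eq_mul,
      inv_mul_cancel₀ (hne _)]
  have hcc : ∀ i j, herm n (fun k => B k i) (fun k => B k j) = 0 := by
    intro i j
    rw [herm_col_col, hcol, Matrix.zero_apply]
  have hB1 : ∀ i j, B i j = B 0 j * B i 0 := by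
    intro i j
    have h0 : (fun k => B k j) - B 0 j • (fun k => B k 0) = (0 : Vec n) := by
      refine eq_zero_of_herm_self_eq_zero ?_ ?_
      · simp [hB00]
      · simp [herm_sub_left, herm_sub_right, herm_smul_left, herm_smul_right, hcc]
    exact sub_eq_zero.mp (congrFun h0 i)
  refine ⟨φ, hφ, fun m => t (φ m), fun k => B k 0, gramMat n *ᵥ fun k => star (B 0 k),
    fun m => inv_ne_zero (hne _), htφ, ?_, ?_, hcc 0 0, ?_, fun x => ?_⟩
  · intro h
    simpa [hB00] using congrFun h 0
  · intro h
    have := congrFun h 0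
    simp [hB00] at this
  · have h00 := herm_row_row B 0 0
    rw [hrow, Matrix.zero_apply] at h00
    rw [herm_self] at h00 ⊢
    rw [← h00]
    simp
  · have hx : Tendsto (fun m => (t (φ m) • (A (φ m) : Mat n)) *ᵥ x) atTop (𝓝 (B *ᵥ x)) :=
      ((continuous_id.matrix_mulVec continuous_const).tendsto B).comp hB
    have hBx : B *ᵥ x = herm n x (gramMat n *ᵥ fun k => star (B 0 k)) • fun k => B k 0 := by
      ext i
      simp only [Matrix.mulVec, dotProduct, Pi.smul_apply, smul_eq_mul]
      rw [Finset.sum_congr rfl fun j _ => by rw [hB1 i j]]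
      rw [Fin.sum_univ_succ]
      simp only [herm, gramMat_mulVec_zero, gramMat_mulVec_succ, RCLike.star_def, map_neg,
        Complex.conj_conj, add_mul, Finset.sum_mul]
      congr 1
      · ring
      · exact Finset.sum_congr rfl fun _ _ => by ring
    rw [← hBx]
    simpa only [Matrix.smul_mulVec] using hx

end Sequences

section ProjectiveSpace

variable {n : ℕ}

lemma continuous_projectivization_mk' :
    Continuous (Projectivization.mk' ℂ : {v : Vec n // v ≠ 0} → Pn n) :=
  continuous_quotient_mk'

lemma tendsto_projectivization_mk {X : Type*} {l : Filter X} {v : X → Vec n} {w : Vec n}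
    (hv : ∀ x, v x ≠ 0) (hw : w ≠ 0) (h : Tendsto v l (𝓝 w)) :
    Tendsto (fun x => Projectivization.mk ℂ (v x) (hv x)) l (𝓝 (Projectivization.mk ℂ w hw)) :=
  (continuous_projectivization_mk'.tendsto ⟨w, hw⟩).comp
    (f := fun x => (⟨v x, hv x⟩ : {v : Vec n // v ≠ 0})) (tendsto_subtype_rng.mpr h)

lemma isOpenMap_projectivization_mk' :
    IsOpenMap (Projectivization.mk' ℂ : {v : Vec n // v ≠ 0} → Pn n) := by
  intro U hU
  have hpre : (Projectivization.mk' ℂ) ⁻¹' (Projectivization.mk' ℂ '' U)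
      = ⋃ c : ℂˣ, (fun v : {v : Vec n // v ≠ 0} =>
          (⟨c • (v : Vec n), (smul_ne_zero_iff_ne c).mpr v.2⟩ : {v : Vec n // v ≠ 0})) ⁻¹' U := by
    ext v
    simp only [Set.mem_preimage, Set.mem_iUnion]
    constructor
    · rintro ⟨w, hwU, hwv⟩
      obtain ⟨c, hc⟩ := (Projectivization.mk_eq_mk_iff ℂ (w : Vec n) v w.2 v.2).mp hwv
      refine ⟨c, ?_⟩
      convert hwU
    · rintro ⟨c, hc⟩
      exact ⟨_, hc, (Projectivization.mk_eq_mk_iff ℂ _ (v : Vec n) _ v.2).mpr ⟨c, rfl⟩⟩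
  refine isOpen_coinduced.mpr ?_
  refine hpre ▸ isOpen_iUnion fun c => hU.preimage ?_
  exact Continuous.subtype_mk (continuous_subtype_val.const_smul c) _

instance : FirstCountableTopology (Pn n) := by
  refine ⟨fun p => ?_⟩
  induction p using Projectivization.ind with | h v hv =>
  have h := (isOpenMap_projectivization_mk'.map_nhds_eq
    (continuous_projectivization_mk'.continuousAt (x := ⟨v, hv⟩)))
  exact h ▸ inferInstance

/-- The orthogonal projector (for the standard Hermitian structure) onto a complex line, as an
array of its entries. -/
noncomputable def lineProjector (p : Pn n) : Fin (n + 1) → Fin (n + 1) → ℂ :=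
  Projectivization.lift
    (fun v i j => (v : Vec n) i * star ((v : Vec n) j) / ∑ k, (v : Vec n) k * star ((v : Vec n) k))
    (by
      rintro ⟨v, hv⟩ ⟨w, hw⟩ t rfl
      have ht : t ≠ 0 := by
        rintro rfl
        simp at hv
      have ht' : star t ≠ 0 := star_ne_zero.mpr ht
      ext i j
      simp only [Pi.smul_apply, smul_eq_mul, star_mul']
      have h1 : ∀ i j, t * w i * (star t * star (w j)) = (t * star t) * (w i * star (w j)) :=
        fun i j => by ring
      simp only [h1, ← Finset.mul_sum]
      exact mul_div_mul_left _ _ (mul_ne_zero ht ht')) p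

lemma sum_mul_star_ne_zero {v : Vec n} (hv : v ≠ 0) : ∑ k, v k * star (v k) ≠ 0 := by
  intro h
  refine hv (funext fun i => ?_)
  have h' : ∑ k, ‖v k‖ ^ 2 = 0 := by
    simp only [RCLike.star_def, Complex.mul_conj, Complex.normSq_eq_norm_sq] at h
    exact_mod_cast h
  rw [Finset.sum_eq_zero_iff_of_nonneg (fun i _ => by positivity)] at h'
  simpa using h' i (Finset.mem_univ i)

lemma continuous_lineProjector : Continuous (lineProjector (n := n)) := by
  refine continuous_coinduced_dom.mpr ?_
  refine continuous_pi fun i => continuous_pi fun j => ?_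
  have hc : ∀ k, Continuous fun v : {v : Vec n // v ≠ 0} => (v : Vec n) k :=
    fun k => (continuous_apply k).comp continuous_subtype_val
  exact ((hc i).mul (hc j).star).div (continuous_finsetSum _ fun k _ => (hc k).mul (hc k).star)
    fun v => sum_mul_star_ne_zero v.2

lemma lineProjector_injective : Function.Injective (lineProjector (n := n)) := by
  intro p q h
  induction p using Projectivization.ind with | h v hv =>
  induction q using Projectivization.ind with | h w hw =>
  obtain ⟨j, hj⟩ := Function.ne_iff.mp hv
  rw [Projectivization.mk_eq_mk_iff']
  refine ⟨star (w j) / (∑ k, w k * star (w k)) / (star (v j) / ∑ k, v k * star (v k)), ?_⟩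
  have hne : star (v j) / ∑ k, v k * star (v k) ≠ 0 :=
    div_ne_zero (star_ne_zero.mpr hj) (sum_mul_star_ne_zero hv)
  ext i
  have hij : v i * star (v j) / (∑ k, v k * star (v k))
      = w i * star (w j) / ∑ k, w k * star (w k) := congrFun (congrFun h i) j
  rw [mul_div_assoc, mul_div_assoc] at hij
  rw [Pi.smul_apply, smul_eq_mul, div_mul_eq_mul_div, div_eq_iff hne, hij, mul_comm]

instance : T2Space (Pn n) :=
  T2Space.of_injective_continuous lineProjector_injective continuous_lineProjector

lemma actGL_mk (A : GLn n) (v : Vec n) (hv : v ≠ 0) :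
    actGL A (Projectivization.mk ℂ v hv) =
      Projectivization.mk ℂ ((A : Mat n) *ᵥ v) (mulVec_ne_zero A hv) :=
  rfl

lemma actGL_mul (A B : GLn n) (p : Pn n) : actGL (A * B) p = actGL A (actGL B p) := by
  induction p using Projectivization.ind with | h v hv =>
  simp only [actGL_mk, Units.val_mul, Matrix.mulVec_mulVec]

lemma actGL_of_mem_center {A : GLn n} (hA : A ∈ Subgroup.center (GLn n)) (p : Pn n) :
    actGL A p = p := by
  induction p using Projectivization.ind with | h v hv =>
  obtain ⟨c, hc⟩ := Matrix.GeneralLinearGroup.mem_center_iff_val_mem_range_scalar.mp hA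
  rw [actGL_mk, Projectivization.mk_eq_mk_iff']
  refine ⟨c, ?_⟩
  rw [← hc]
  ext i
  simp [Matrix.mulVec_diagonal]

lemma act_mk (A : GLn n) (p : Pn n) : act (QuotientGroup.mk A : PGLn n) p = actGL A p := by
  obtain ⟨c, hc⟩ := QuotientGroup.mk_out_eq_mul (Subgroup.center (GLn n)) A
  rw [act, hc, actGL_mul, actGL_of_mem_center c.2]

lemma act_mul (g h : PGLn n) (p : Pn n) : act (g * h) p = act g (act h p) := by
  induction g using QuotientGroup.induction_on with | H A =>
  induction h using QuotientGroup.induction_on with | H B =>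
  rw [← QuotientGroup.mk_mul, act_mk, act_mk, act_mk, actGL_mul]

lemma act_one (p : Pn n) : act 1 p = p := by
  rw [← QuotientGroup.mk_one, act_mk, actGL_of_mem_center (one_mem _)]

lemma continuous_act (g : PGLn n) : Continuous (act g) := by
  refine continuous_coinduced_dom.mpr ?_
  have hc : Continuous fun v : {v : Vec n // v ≠ 0} => (⟨((Quotient.out g : GLn n) : Mat n) *ᵥ v,
      mulVec_ne_zero _ v.2⟩ : {v : Vec n // v ≠ 0}) :=
    Continuous.subtype_mk ((Continuous.matrix_mulVec continuous_const continuous_id).comp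
      continuous_subtype_val) _
  exact continuous_projectivization_mk'.comp hc

end ProjectiveSpace

section LimitSet

variable {n : ℕ}

lemma continuous_herm_left (v : Vec n) : Continuous fun u => herm n u v := by
  unfold herm
  fun_prop

lemma herm_single_zero_re_neg :
    (herm n (Pi.single 0 1) (Pi.single 0 1)).re < 0 := by
  simp [herm]

lemma single_zero_ne_zero : (Pi.single 0 1 : Vec n) ≠ 0 := by
  simp

lemma exists_subseq_tendsto_act {G : Subgroup (PGLn n)} (hPU : (G : Set (PGLn n)) ⊆ PUset n)
    (hdisc : DiscreteTopology ↥G) {g : ℕ → G} (hg : Function.Injective g) :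
    ∃ φ : ℕ → ℕ, StrictMono φ ∧ ∃ (A : ℕ → GLn n) (s : ℕ → ℂ) (a b : Vec n) (ha : a ≠ 0),
      (∀ m, A m ∈ unitaryGL n) ∧ (∀ m, (QuotientGroup.mk (A m) : PGLn n) = g (φ m)) ∧
      Tendsto s atTop (𝓝 0) ∧ b ≠ 0 ∧ herm n a a = 0 ∧ herm n b b = 0 ∧
      (∀ x : Vec n, Tendsto (fun m => s m • ((A m : Mat n) *ᵥ x)) atTop (𝓝 (herm n x b • a))) ∧
      ∀ (x : Vec n) (hx : x ≠ 0), herm n x b ≠ 0 →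
        Tendsto (fun m => act (g (φ m) : PGLn n) (Projectivization.mk ℂ x hx)) atTop
          (𝓝 (Projectivization.mk ℂ a ha)) := by
  choose A hA hAg using fun m => hPU (g m).2
  obtain ⟨φ, hφ, s, a, b, hs, hs0, ha, hb, haa, hbb, hlim⟩ :=
    exists_subseq_tendsto_rank_one hdisc hg hA hAg
  refine ⟨φ, hφ, fun m => A (φ m), s, a, b, ha, fun m => hA _, fun m => hAg _, hs0, hb, haa, hbb,
    hlim, fun x hx hxb => ?_⟩
  have h := tendsto_projectivization_mk
    (fun m => smul_ne_zero (hs m) (mulVec_ne_zero (A (φ m)) hx)) (smul_ne_zero hxb ha) (hlim x)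
  have h1 : Projectivization.mk ℂ (herm n x b • a) (smul_ne_zero hxb ha)
      = Projectivization.mk ℂ a ha := (Projectivization.mk_eq_mk_iff' ℂ _ _ _ _).mpr ⟨_, rfl⟩
  rw [h1] at h
  refine h.congr fun m => ?_
  rw [← hAg, act_mk, actGL_mk]
  exact (Projectivization.mk_eq_mk_iff' ℂ _ _ _ _).mpr ⟨_, rfl⟩

/-- Every limit point is the limit, along some sequence in the group, of all points away from a
single complex hyperplane tangent to the boundary. -/
lemma exists_seq_of_mem_LambdaCG {G : Subgroup (PGLn n)} (hPU : (G : Set (PGLn n)) ⊆ PUset n)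
    (hdisc : DiscreteTopology ↥G) {z : Pn n} (hz : z ∈ LambdaCG G) :
    ∃ (g : ℕ → G) (A : ℕ → GLn n) (s : ℕ → ℂ) (a b : Vec n) (ha : a ≠ 0),
      z = Projectivization.mk ℂ a ha ∧
      (∀ m, A m ∈ unitaryGL n) ∧ (∀ m, (QuotientGroup.mk (A m) : PGLn n) = g m) ∧
      Tendsto s atTop (𝓝 0) ∧ b ≠ 0 ∧ herm n a a = 0 ∧ herm n b b = 0 ∧
      (∀ x : Vec n, Tendsto (fun m => s m • ((A m : Mat n) *ᵥ x)) atTop (𝓝 (herm n x b • a))) ∧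
      ∀ (x : Vec n) (hx : x ≠ 0), herm n x b ≠ 0 →
        Tendsto (fun m => act (g m : PGLn n) (Projectivization.mk ℂ x hx)) atTop (𝓝 z) := by
  obtain ⟨g, hg, hgz⟩ := hz
  obtain ⟨φ, hφ, A, s, a, b, ha, hA, hAg, hs, hb, haa, hbb, hlim, hact⟩ :=
    exists_subseq_tendsto_act hPU hdisc hg
  have hza : z = Projectivization.mk ℂ a ha :=
    tendsto_nhds_unique (hgz.comp hφ.tendsto_atTop) (hact _ single_zero_ne_zero
      (herm_ne_zero_of_neg_of_null herm_single_zero_re_neg hb hbb))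
  exact ⟨fun m => g (φ m), A, s, a, b, ha, hza, hA, hAg, hs, hb, haa, hbb, hlim, hza ▸ hact⟩

lemma LambdaCG_subset_Hbdry {G : Subgroup (PGLn n)} (hPU : (G : Set (PGLn n)) ⊆ PUset n)
    (hdisc : DiscreteTopology ↥G) : LambdaCG G ⊆ Hbdry n := by
  intro z hz
  obtain ⟨-, -, -, a, -, ha, hza, -, -, -, -, haa, -⟩ := exists_seq_of_mem_LambdaCG hPU hdisc hz
  exact ⟨a, ha, hza, haa⟩

lemma mem_accPts_iff {G : Subgroup (PGLn n)} {x z : Pn n} :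
    z ∈ accPts G x ↔ ∀ U ∈ 𝓝 z, {g : G | act (g : PGLn n) x ∈ U}.Infinite := by
  constructor
  · rintro ⟨g, hg, hgz⟩ U hU hfin
    obtain ⟨N, hN⟩ := eventually_atTop.mp (hgz hU)
    refine (Set.infinite_of_injective_forall_mem (f := fun m => g (N + m)) ?_ ?_) hfin
    · intro i j hij
      exact Nat.add_left_cancel (hg hij)
    · exact fun m => hN _ (Nat.le_add_right _ _)
  · intro h
    obtain ⟨U, hU⟩ := (𝓝 z).exists_antitone_basis
    obtain ⟨f, hf, hf'⟩ := exists_seq_of_forall_finset_exists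
      (fun p : ℕ × G => act (p.2 : PGLn n) x ∈ U p.1) (fun p q => p.1 < q.1 ∧ p.2 ≠ q.2) (by
        classical
        intro s _
        obtain ⟨γ, hγ, hγs⟩ := (h _ (hU.mem (s.sup Prod.fst + 1))).exists_notMem_finset
          (s.image Prod.snd)
        refine ⟨(s.sup Prod.fst + 1, γ), hγ, fun p hp => ⟨?_, ?_⟩⟩
        · exact Nat.lt_succ_of_le (Finset.le_sup (f := Prod.fst) hp)
        · rintro rfl
          exact hγs (Finset.mem_image_of_mem _ hp))
    refine ⟨fun m => (f m).2, ?_, ?_⟩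
    · intro i j hij
      by_contra hne
      rcases lt_or_gt_of_ne hne with hlt | hlt
      · exact (hf' _ _ hlt).2 hij
      · exact (hf' _ _ hlt).2 hij.symm
    · have hmono : StrictMono fun m => (f m).1 := fun i j hij => (hf' i j hij).1
      refine hU.1.tendsto_right_iff.mpr fun k _ => ?_
      filter_upwards [eventually_ge_atTop k] with m hm
      exact hU.2 (hm.trans (hmono.id_le m)) (hf m)

lemma isClosed_accPts (G : Subgroup (PGLn n)) (x : Pn n) : IsClosed (accPts G x) := by
  refine isClosed_of_closure_subset fun z hz => mem_accPts_iff.mpr fun U hU => ?_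
  obtain ⟨V, hVU, hV, hzV⟩ := mem_nhds_iff.mp hU
  obtain ⟨w, hwV, hw⟩ := mem_closure_iff.mp hz V hV hzV
  exact (mem_accPts_iff.mp hw V (hV.mem_nhds hwV)).mono fun γ hγ => hVU hγ

lemma act_mem_accPts {G : Subgroup (PGLn n)} {x z : Pn n} (h : G) (hz : z ∈ accPts G x) :
    act (h : PGLn n) z ∈ accPts G x := by
  obtain ⟨g, hg, hgz⟩ := hz
  refine ⟨fun m => h * g m, (mul_right_injective h).comp hg, ?_⟩
  refine (((continuous_act (h : PGLn n)).tendsto z).comp hgz).congr fun m => ?_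
  rw [Function.comp_apply, Subgroup.coe_mul, act_mul]

lemma act_image_accPts (G : Subgroup (PGLn n)) (x : Pn n) (h : G) :
    act (h : PGLn n) '' accPts G x = accPts G x := by
  refine Set.Subset.antisymm (Set.image_subset_iff.mpr fun z hz => act_mem_accPts h hz) ?_
  intro z hz
  refine ⟨_, act_mem_accPts h⁻¹ hz, ?_⟩
  rw [← act_mul, ← Subgroup.coe_mul, mul_inv_cancel, Subgroup.coe_one, act_one]

end LimitSet

section FixedPoints

variable {n : ℕ}

lemma exists_mulVec_eq_smul_of_act_eq {A : GLn n} {v : Vec n} {hv : v ≠ 0}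
    (h : act (QuotientGroup.mk A : PGLn n) (Projectivization.mk ℂ v hv)
      = Projectivization.mk ℂ v hv) : ∃ c : ℂ, c ≠ 0 ∧ (A : Mat n) *ᵥ v = c • v := by
  rw [act_mk, actGL_mk, Projectivization.mk_eq_mk_iff'] at h
  obtain ⟨c, hc⟩ := h
  refine ⟨c, ?_, hc.symm⟩
  rintro rfl
  rw [zero_smul] at hc
  exact mulVec_ne_zero A hv hc.symm

lemma pow_mulVec_of_mulVec {A : GLn n} {v : Vec n} {c : ℂ} (h : (A : Mat n) *ᵥ v = c • v)
    (k : ℕ) : ((A ^ k : GLn n) : Mat n) *ᵥ v = c ^ k • v := by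
  induction k with
  | zero => simp
  | succ k ih =>
    rw [pow_succ, Units.val_mul, ← Matrix.mulVec_mulVec, h, Matrix.mulVec_smul, ih, smul_smul,
      pow_succ, mul_comm]

lemma unitaryGL_pow {A : GLn n} (hA : A ∈ unitaryGL n) (k : ℕ) : A ^ k ∈ unitaryGL n := by
  induction k with
  | zero => intro u v; simp
  | succ k ih => rw [pow_succ]; exact unitaryGL_mul ih hA

lemma exists_dual_eigenvector {A : GLn n} (hA : A ∈ unitaryGL n) {p : Vec n} (hp : p ≠ 0)
    {c : ℂ} (hc : c ≠ 0) (h : (A : Mat n) *ᵥ p = c • p) :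
    ∃ v : Vec n, v ≠ 0 ∧ (A : Mat n) *ᵥ v = ((starRingEnd ℂ) c)⁻¹ • v := by
  have hinv : ((A⁻¹ : GLn n) : Mat n) *ᵥ p = c⁻¹ • p := by
    rw [← inv_smul_smul₀ hc (((A⁻¹ : GLn n) : Mat n) *ᵥ p), ← Matrix.mulVec_smul, ← h,
      inv_mul_mulVec]
  rw [inv_eq_gramMat_mul hA, ← Matrix.mulVec_mulVec, ← Matrix.mulVec_mulVec] at hinv
  have hJ : (A : Mat n)ᴴ *ᵥ (gramMat n *ᵥ p) = c⁻¹ • (gramMat n *ᵥ p) := by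
    rw [← Matrix.mulVec_smul, ← hinv,
      Matrix.mulVec_mulVec ((A : Mat n)ᴴ *ᵥ (gramMat n *ᵥ p)), gramMat_mul_self, Matrix.one_mulVec]
  have hJp : gramMat n *ᵥ p ≠ 0 := by
    intro h0
    rw [← Matrix.one_mulVec p, ← gramMat_mul_self, ← Matrix.mulVec_mulVec, h0,
      Matrix.mulVec_zero] at hp
    exact hp rfl
  have hdet : ((A : Mat n)ᴴ - c⁻¹ • (1 : Mat n)).det = 0 := by
    refine Matrix.exists_mulVec_eq_zero_iff.mp ⟨_, hJp, ?_⟩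
    rw [Matrix.sub_mulVec, hJ, Matrix.smul_mulVec, Matrix.one_mulVec, sub_self]
  have hdet' : ((A : Mat n) - ((starRingEnd ℂ) c)⁻¹ • (1 : Mat n)).det = 0 := by
    rw [← star_eq_zero, ← Matrix.det_conjTranspose, ← hdet]
    congr 1
    simp
  obtain ⟨v, hv, hv0⟩ := Matrix.exists_mulVec_eq_zero_iff.mpr hdet'
  refine ⟨v, hv, ?_⟩
  rwa [Matrix.sub_mulVec, Matrix.smul_mulVec, Matrix.one_mulVec, sub_eq_zero] at hv0

lemma herm_self_eq_zero_of_eigenvector {A : GLn n} (hA : A ∈ unitaryGL n) {v : Vec n} {c : ℂ}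
    (h : (A : Mat n) *ᵥ v = c • v) (hc : ‖c‖ ≠ 1) : herm n v v = 0 := by
  have h1 := hA v v
  rw [h, herm_smul_left, herm_smul_right, ← mul_assoc, Complex.mul_conj,
    Complex.normSq_eq_norm_sq] at h1
  by_contra hne
  have h2 := mul_right_cancel₀ hne (h1.trans (one_mul _).symm)
  have h3 : ‖c‖ ^ 2 = 1 := by exact_mod_cast h2
  exact hc ((pow_eq_one_iff_of_nonneg (norm_nonneg c) two_ne_zero).mp h3)

/-- If a discrete group fixes a boundary point and has another limit point, then it contains an
element acting loxodromically at the fixed point. -/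
lemma exists_one_lt_norm_eigenvalue {G : Subgroup (PGLn n)}
    (hPU : (G : Set (PGLn n)) ⊆ PUset n) (hdisc : DiscreteTopology ↥G) {p : Vec n} (hp : p ≠ 0)
    (hpp : herm n p p = 0)
    (hfix : ∀ g : G, act (g : PGLn n) (Projectivization.mk ℂ p hp) = Projectivization.mk ℂ p hp)
    {z : Pn n} (hz : z ∈ LambdaCG G) (hzp : z ≠ Projectivization.mk ℂ p hp) :
    ∃ A ∈ unitaryGL n, (QuotientGroup.mk A : PGLn n) ∈ G ∧
      ∃ c : ℂ, 1 < ‖c‖ ∧ (A : Mat n) *ᵥ p = c • p := by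
  obtain ⟨g, A, s, a, b, ha, hza, hA, hAg, hs, hb, haa, hbb, hlim, -⟩ :=
    exists_seq_of_mem_LambdaCG hPU hdisc hz
  have hap : herm n a p ≠ 0 := by
    intro h0
    refine hzp (hza.trans ?_)
    exact (Projectivization.mk_eq_mk_iff' ℂ _ _ _ _).mpr
      (exists_smul_eq_of_herm_eq_zero hp haa hpp h0)
  choose c hc hcp using fun m => exists_mulVec_eq_smul_of_act_eq (A := A m) (hAg m ▸ hfix (g m))
  by_cases hall : ∀ m, 1 ≤ ‖c m‖
  · exfalso
    set e : Vec n := Pi.single 0 1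
    have heb : herm n e b ≠ 0 := herm_ne_zero_of_neg_of_null herm_single_zero_re_neg hb hbb
    have h1 := ((continuous_herm_left p).tendsto _).comp (hlim e)
    have h2 : Tendsto (fun m => herm n (s m • ((A m : Mat n) *ᵥ e)) p) atTop (𝓝 0) := by
      have hs' : Tendsto (fun m => ‖s m‖ * ‖herm n e p‖) atTop (𝓝 0) := by
        simpa using hs.norm.mul_const ‖herm n e p‖
      refine squeeze_zero_norm (fun m => ?_) hs'
      rw [herm_smul_left, norm_mul]
      refine mul_le_mul_of_nonneg_left ?_ (norm_nonneg _)
      rw [← hA m e p, hcp m, herm_smul_right, norm_mul, RCLike.norm_conj]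
      exact le_mul_of_one_le_left (norm_nonneg _) (hall m)
    have h3 := tendsto_nhds_unique h1 h2
    rw [herm_smul_left] at h3
    exact mul_ne_zero heb hap h3
  · push Not at hall
    obtain ⟨m, hm⟩ := hall
    refine ⟨(A m)⁻¹, unitaryGL_inv (hA m), ?_, (c m)⁻¹, ?_, ?_⟩
    · rw [QuotientGroup.mk_inv, hAg]
      exact G.inv_mem (g m).2
    · rw [norm_inv]
      exact (one_lt_inv₀ (norm_pos_iff.mpr (hc m))).mpr hm
    · rw [← inv_smul_smul₀ (hc m) ((((A m)⁻¹ : GLn n) : Mat n) *ᵥ p), ← Matrix.mulVec_smul,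
        ← hcp m, inv_mul_mulVec]

/-- Let `A` be loxodromic with fixed points `p` and `a`, and let `H` fix `p`. Then the conjugates
`A⁻ᵐ H Aᵐ` move a point of the axis of `A` by a bounded amount. -/
lemma exists_norm_herm_conj_le {A H : GLn n} (hA : A ∈ unitaryGL n) {p a : Vec n}
    (hpp : herm n p p = 0) {c μ : ℂ} (hc : 1 < ‖c‖) (hAp : (A : Mat n) *ᵥ p = c • p)
    (hAa : (A : Mat n) *ᵥ a = ((starRingEnd ℂ) c)⁻¹ • a) (hHp : (H : Mat n) *ᵥ p = μ • p)
    (t : ℂ) : ∃ C : ℝ, ∀ m : ℕ,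
      ‖herm n ((((A ^ m)⁻¹ * H * A ^ m : GLn n) : Mat n) *ᵥ (p - t • a)) (p - t • a)‖ ≤ C := by
  refine ⟨‖(starRingEnd ℂ) t * (μ * herm n p a)‖ + ‖t * herm n ((H : Mat n) *ᵥ a) p‖
    + ‖t * (starRingEnd ℂ) t * herm n ((H : Mat n) *ᵥ a) a‖, fun m => ?_⟩
  set d : ℂ := ((starRingEnd ℂ) c)⁻¹ with hd
  have hc0 : c ≠ 0 := by
    rintro rfl
    simp at hc
    linarith
  have hy : ((A ^ m : GLn n) : Mat n) *ᵥ (p - t • a) = c ^ m • p - (t * d ^ m) • a := by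
    rw [Matrix.mulVec_sub, Matrix.mulVec_smul, pow_mulVec_of_mulVec hAp, pow_mulVec_of_mulVec hAa,
      smul_smul]
  have hconj : herm n ((((A ^ m)⁻¹ * H * A ^ m : GLn n) : Mat n) *ᵥ (p - t • a)) (p - t • a)
      = herm n ((H : Mat n) *ᵥ (c ^ m • p - (t * d ^ m) • a)) (c ^ m • p - (t * d ^ m) • a) := by
    rw [← hy, ← unitaryGL_pow hA m, Units.val_mul, Units.val_mul, ← Matrix.mulVec_mulVec,
      ← Matrix.mulVec_mulVec, mul_inv_mulVec]
  have hcd : (starRingEnd ℂ) d * c = 1 := by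
    rw [hd, map_inv₀, Complex.conj_conj, inv_mul_cancel₀ hc0]
  have hcdm : (starRingEnd ℂ) d ^ m * c ^ m = 1 := by rw [← mul_pow, hcd, one_pow]
  have hcdm' : d ^ m * (starRingEnd ℂ) c ^ m = 1 := by
    have := congrArg (starRingEnd ℂ) hcdm
    simpa using this
  have hexp : herm n ((H : Mat n) *ᵥ (c ^ m • p - (t * d ^ m) • a))
        (c ^ m • p - (t * d ^ m) • a)
      = -((starRingEnd ℂ) t * (μ * herm n p a)) - t * herm n ((H : Mat n) *ᵥ a) p
        + (d ^ m * (starRingEnd ℂ) d ^ m)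
          * (t * (starRingEnd ℂ) t * herm n ((H : Mat n) *ᵥ a) a) := by
    simp only [Matrix.mulVec_sub, Matrix.mulVec_smul, hHp, herm_sub_left, herm_sub_right,
      herm_smul_left, herm_smul_right, hpp, map_mul, map_pow]
    linear_combination (-(starRingEnd ℂ) t * μ * herm n p a) * hcdm
      - (t * herm n ((H : Mat n) *ᵥ a) p) * hcdm'
  have hdm : ‖d ^ m * (starRingEnd ℂ) d ^ m‖ ≤ 1 := by
    have hd1 : ‖d‖ ≤ 1 := by
      rw [hd, norm_inv, RCLike.norm_conj]
      exact inv_le_one_of_one_le₀ hc.le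
    rw [norm_mul, norm_pow, norm_pow, RCLike.norm_conj]
    exact mul_le_one₀ (pow_le_one₀ (norm_nonneg _) hd1) (by positivity)
      (pow_le_one₀ (norm_nonneg _) hd1)
  rw [hconj, hexp]
  refine (norm_add_le _ _).trans (add_le_add ((norm_sub_le _ _).trans ?_) ?_)
  · rw [norm_neg]
  · rw [norm_mul]
    exact mul_le_of_le_one_left (norm_nonneg _) hdm

/-- In a discrete group fixing one fixed point of a loxodromic element, every element also fixes
the other one. -/
lemma act_eq_of_fixes_attracting {G : Subgroup (PGLn n)} (hdisc : DiscreteTopology ↥G)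
    {A H : GLn n} (hA : A ∈ unitaryGL n) (hH : H ∈ unitaryGL n)
    (hAG : (QuotientGroup.mk A : PGLn n) ∈ G) (hHG : (QuotientGroup.mk H : PGLn n) ∈ G)
    {p a : Vec n} (ha : a ≠ 0) (hpp : herm n p p = 0) (haa : herm n a a = 0)
    (hpa : herm n p a ≠ 0) {c μ : ℂ} (hc : 1 < ‖c‖) (hAp : (A : Mat n) *ᵥ p = c • p)
    (hAa : (A : Mat n) *ᵥ a = ((starRingEnd ℂ) c)⁻¹ • a) (hHp : (H : Mat n) *ᵥ p = μ • p) :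
    act (QuotientGroup.mk H : PGLn n) (Projectivization.mk ℂ a ha)
      = Projectivization.mk ℂ a ha := by
  set F : ℕ → GLn n := fun m => (A ^ m)⁻¹ * H * A ^ m with hF
  set α : G := ⟨_, hAG⟩ with hα
  set η : G := ⟨_, hHG⟩ with hη
  set f : ℕ → G := fun m => (α ^ m)⁻¹ * η * α ^ m with hf
  have hFU : ∀ m, F m ∈ unitaryGL n := fun m =>
    unitaryGL_mul (unitaryGL_mul (unitaryGL_inv (unitaryGL_pow hA m)) hH) (unitaryGL_pow hA m)
  have hFf : ∀ m, (QuotientGroup.mk (F m) : PGLn n) = f m := fun m => rfl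
  have hninj : ¬ Function.Injective f := by
    intro hinj
    obtain ⟨φ, hφ, s, a', b, hs, hs0, ha', hb, haa', hbb, hlim⟩ :=
      exists_subseq_tendsto_rank_one hdisc hinj hFU hFf
    set y : Vec n := p - herm n p a • a with hy
    have hyy : (herm n y y).re < 0 := by
      have : herm n y y = ((-2 * ‖herm n p a‖ ^ 2 : ℝ) : ℂ) := by
        have h1 : herm n a p = (starRingEnd ℂ) (herm n p a) := (herm_conj p a).symm
        have h2 : (starRingEnd ℂ) (herm n p a) * herm n p a = ((‖herm n p a‖ ^ 2 : ℝ) : ℂ) := by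
          rw [mul_comm, Complex.mul_conj, Complex.normSq_eq_norm_sq]
        simp only [hy, herm_sub_left, herm_sub_right, herm_smul_left, herm_smul_right, hpp, haa,
          h1]
        rw [Complex.ofReal_mul, ← h2]
        push_cast
        ring
      rw [this, Complex.ofReal_re]
      have := norm_pos_iff.mpr hpa
      nlinarith [sq_pos_of_pos this]
    obtain ⟨C, hC⟩ := exists_norm_herm_conj_le (H := H) hA hpp hc hAp hAa hHp (herm n p a)
    have h1 := ((continuous_herm_left y).tendsto _).comp (hlim y)
    have h2 : Tendsto (fun m => herm n (s m • ((F (φ m) : Mat n) *ᵥ y)) y) atTop (𝓝 0) := by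
      have hs' : Tendsto (fun m => ‖s m‖ * C) atTop (𝓝 0) := by
        simpa using hs0.norm.mul_const C
      refine squeeze_zero_norm (fun m => ?_) hs'
      rw [herm_smul_left, norm_mul]
      exact mul_le_mul_of_nonneg_left (hC (φ m)) (norm_nonneg _)
    have h3 := tendsto_nhds_unique h1 h2
    rw [herm_smul_left] at h3
    refine mul_ne_zero (herm_ne_zero_of_neg_of_null hyy hb hbb) (fun h0 => ?_) h3
    exact herm_ne_zero_of_neg_of_null hyy ha' haa' (herm_eq_zero_symm h0)
  obtain ⟨k, hk, hcomm⟩ : ∃ k : ℕ, 0 < k ∧ α ^ k * η = η * α ^ k := by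
    have key : ∀ i j, i < j → f i = f j → ∃ k : ℕ, 0 < k ∧ α ^ k * η = η * α ^ k := by
      intro i j hij h
      obtain ⟨k, rfl⟩ := Nat.exists_eq_add_of_lt hij
      refine ⟨k + 1, k.succ_pos, ?_⟩
      simp only [hf] at h
      rw [show i + k + 1 = (k + 1) + i by ring, pow_add, _root_.mul_inv_rev] at h
      simp only [mul_assoc] at h
      have h4 := mul_left_cancel h
      simp only [← mul_assoc] at h4
      have h5 := mul_right_cancel h4
      rw [mul_assoc, eq_inv_mul_iff_mul_eq] at h5
      exact h5
    simp only [Function.Injective, not_forall] at hninj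
    obtain ⟨i, j, hij, hne⟩ := hninj
    rcases lt_or_gt_of_ne hne with h | h
    · exact key i j h hij
    · exact key j i h hij.symm
  have hfixed : act (QuotientGroup.mk (A ^ k) : PGLn n)
      (Projectivization.mk ℂ ((H : Mat n) *ᵥ a) (mulVec_ne_zero H ha))
      = Projectivization.mk ℂ ((H : Mat n) *ᵥ a) (mulVec_ne_zero H ha) := by
    have h1 : act (QuotientGroup.mk (A ^ k) : PGLn n) (Projectivization.mk ℂ a ha)
        = Projectivization.mk ℂ a ha := by
      rw [act_mk, actGL_mk, Projectivization.mk_eq_mk_iff']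
      exact ⟨_, (pow_mulVec_of_mulVec hAa k).symm⟩
    have h2 : (QuotientGroup.mk (A ^ k) : PGLn n) * QuotientGroup.mk H
        = QuotientGroup.mk H * QuotientGroup.mk (A ^ k) := congrArg Subtype.val hcomm
    rw [← actGL_mk H a ha, ← act_mk, ← act_mul, h2, act_mul, h1]
  obtain ⟨ν, -, hν⟩ := exists_mulVec_eq_smul_of_act_eq hfixed
  rw [act_mk, actGL_mk, Projectivization.mk_eq_mk_iff']
  set x : Vec n := (H : Mat n) *ᵥ a with hx
  have hxx : herm n x x = 0 := by rw [hx, hH, haa]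
  refine exists_smul_eq_of_herm_eq_zero ha hxx haa ?_
  by_contra hxa
  have hxp : herm n x p ≠ 0 := by
    intro h0
    have h1 := hH a p
    rw [hHp, herm_smul_right, ← hx, h0, mul_zero] at h1
    exact hpa (herm_eq_zero_symm h1.symm)
  have e1 : ν * (starRingEnd ℂ) (c ^ k) = 1 := by
    have h1 := unitaryGL_pow hA k x p
    rw [hν, pow_mulVec_of_mulVec hAp, herm_smul_left, herm_smul_right, ← mul_assoc] at h1
    exact mul_right_cancel₀ hxp (h1.trans (one_mul _).symm)
  have e2 : ν * (starRingEnd ℂ) (((starRingEnd ℂ) c)⁻¹ ^ k) = 1 := by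
    have h1 := unitaryGL_pow hA k x a
    rw [hν, pow_mulVec_of_mulVec hAa, herm_smul_left, herm_smul_right, ← mul_assoc] at h1
    exact mul_right_cancel₀ hxa (h1.trans (one_mul _).symm)
  have n1 := congrArg norm e1
  have n2 := congrArg norm e2
  rw [norm_mul, RCLike.norm_conj, norm_pow, norm_one] at n1
  rw [norm_mul, RCLike.norm_conj, norm_pow, norm_inv, RCLike.norm_conj, norm_one, inv_pow] at n2
  have hck : 1 < ‖c‖ ^ k := one_lt_pow₀ hc hk.ne'
  have h4 : ‖ν‖ = ‖c‖ ^ k := by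
    rw [mul_inv_eq_iff_eq_mul₀ (by positivity), one_mul] at n2
    exact n2
  rw [h4] at n1
  nlinarith

lemma eq_or_eq_of_mem_LambdaCG_of_fixes {G : Subgroup (PGLn n)}
    (hPU : (G : Set (PGLn n)) ⊆ PUset n) (hdisc : DiscreteTopology ↥G) {p a : Vec n} (hp : p ≠ 0)
    (ha : a ≠ 0) (hpp : herm n p p = 0) (hpa : herm n p a ≠ 0)
    (hfp : ∀ g : G, act (g : PGLn n) (Projectivization.mk ℂ p hp) = Projectivization.mk ℂ p hp)
    (hfa : ∀ g : G, act (g : PGLn n) (Projectivization.mk ℂ a ha) = Projectivization.mk ℂ a ha)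
    {z : Pn n} (hz : z ∈ LambdaCG G) :
    z = Projectivization.mk ℂ p hp ∨ z = Projectivization.mk ℂ a ha := by
  obtain ⟨g, -, -, -, b, -, -, -, -, -, hb, -, hbb, -, hact⟩ :=
    exists_seq_of_mem_LambdaCG hPU hdisc hz
  by_cases hpb : herm n p b = 0
  · right
    have hab : herm n a b ≠ 0 := by
      intro hab
      obtain ⟨r, rfl⟩ := exists_smul_eq_of_herm_eq_zero hb hpp hbb hpb
      exact hpa (by rw [herm_smul_left, herm_eq_zero_symm hab, mul_zero])
    refine tendsto_nhds_unique (hact a ha hab) ?_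
    simp only [hfa]
    exact tendsto_const_nhds
  · left
    refine tendsto_nhds_unique (hact p hp hpb) ?_
    simp only [hfp]
    exact tendsto_const_nhds

/-- A non-elementary discrete subgroup of `PU(1,n)` has no global fixed point in the boundary. -/
lemma not_forall_act_eq {G : Subgroup (PGLn n)}
    (hPU : (G : Set (PGLn n)) ⊆ PUset n) (hdisc : DiscreteTopology ↥G)
    (h3 : ∃ a ∈ LambdaCG G, ∃ b ∈ LambdaCG G, ∃ c ∈ LambdaCG G, a ≠ b ∧ a ≠ c ∧ b ≠ c)
    {p : Vec n} (hp : p ≠ 0) (hpp : herm n p p = 0) :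
    ¬ ∀ g : G, act (g : PGLn n) (Projectivization.mk ℂ p hp) = Projectivization.mk ℂ p hp := by
  intro hfix
  obtain ⟨z₁, hz₁, z₂, hz₂, z₃, hz₃, h₁₂, h₁₃, h₂₃⟩ := h3
  obtain ⟨z, hz, hzp⟩ : ∃ z ∈ LambdaCG G, z ≠ Projectivization.mk ℂ p hp := by
    by_cases h : z₁ = Projectivization.mk ℂ p hp
    · exact ⟨z₂, hz₂, h ▸ h₁₂.symm⟩
    · exact ⟨z₁, hz₁, h⟩
  obtain ⟨A, hA, hAG, c, hc, hAp⟩ := exists_one_lt_norm_eigenvalue hPU hdisc hp hpp hfix hz hzp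
  have hc0 : c ≠ 0 := norm_pos_iff.mp (one_pos.trans hc)
  obtain ⟨a, ha, hAa⟩ := exists_dual_eigenvector hA hp hc0 hAp
  have hd : ‖((starRingEnd ℂ) c)⁻¹‖ < 1 := by
    rw [norm_inv, RCLike.norm_conj]
    exact inv_lt_one_of_one_lt₀ hc
  have haa : herm n a a = 0 := herm_self_eq_zero_of_eigenvector hA hAa hd.ne
  have hpa : herm n p a ≠ 0 := by
    intro h0
    obtain ⟨r, rfl⟩ := exists_smul_eq_of_herm_eq_zero ha hpp haa h0
    rw [Matrix.mulVec_smul, hAa, smul_comm] at hAp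
    have h1 := smul_left_injective ℂ hp hAp
    rw [h1] at hd
    exact absurd hc hd.not_gt
  have hfa : ∀ g : G, act (g : PGLn n) (Projectivization.mk ℂ a ha)
      = Projectivization.mk ℂ a ha := by
    intro g
    obtain ⟨H, hH, hHg⟩ := hPU g.2
    rw [← hHg]
    obtain ⟨μ, -, hμ⟩ := exists_mulVec_eq_smul_of_act_eq (A := H) (hHg ▸ hfix g)
    exact act_eq_of_fixes_attracting hdisc hA hH hAG (hHg ▸ g.2) ha hpp haa hpa hc hAp hAa hμ
  have hall : ∀ w ∈ LambdaCG G, w = Projectivization.mk ℂ p hp ∨ w = Projectivization.mk ℂ a ha :=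
    fun w hw => eq_or_eq_of_mem_LambdaCG_of_fixes hPU hdisc hp ha hpp hpa hfix hfa hw
  grind

end FixedPoints

/-- For a non-elementary discrete subgroup `G` of `PU(1,n)` (the limit
set has more than two points), `Λ_CG(G)` is the unique minimal nonempty closed
`G`-invariant subset of `∂𝐇ⁿ_ℂ`: it is itself a nonempty closed `G`-invariant subset of
`∂𝐇ⁿ_ℂ`, and it is contained in every nonempty closed `G`-invariant subset of `∂𝐇ⁿ_ℂ`. -/
theorem limit_set_unique_minimal_closed_invariant
    (n : ℕ) (hn : 1 ≤ n) (G : Subgroup (PGLn n))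
    (hPU : (G : Set (PGLn n)) ⊆ PUset n) (hdisc : DiscreteTopology ↥G)
    (h3 : ∃ a ∈ LambdaCG G, ∃ b ∈ LambdaCG G, ∃ c ∈ LambdaCG G,
      a ≠ b ∧ a ≠ c ∧ b ≠ c) :
    (LambdaCG G ⊆ Hbdry n ∧ (LambdaCG G).Nonempty ∧ IsClosed (LambdaCG G) ∧
      ∀ g : G, act (g : PGLn n) '' LambdaCG G = LambdaCG G) ∧
    ∀ S : Set (Pn n), S ⊆ Hbdry n → S.Nonempty → IsClosed S →
      (∀ g : G, act (g : PGLn n) '' S = S) → LambdaCG G ⊆ S := by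
  refine ⟨⟨LambdaCG_subset_Hbdry hPU hdisc, h3.imp fun _ h => h.1, isClosed_accPts G _,
    act_image_accPts G _⟩, fun S hS hSne hSc hSinv z hz => ?_⟩
  obtain ⟨g, -, -, -, b, -, -, -, -, -, hb, -, hbb, -, hact⟩ :=
    exists_seq_of_mem_LambdaCG hPU hdisc hz
  obtain ⟨x, hx, hxS, hxb⟩ : ∃ (x : Vec n) (hx : x ≠ 0),
      Projectivization.mk ℂ x hx ∈ S ∧ herm n x b ≠ 0 := by
    by_contra! hcon
    have hSb : ∀ q ∈ S, q = Projectivization.mk ℂ b hb := by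
      intro q hq
      obtain ⟨v, hv, rfl, hvv⟩ := hS hq
      exact (Projectivization.mk_eq_mk_iff' ℂ _ _ _ _).mpr
        (exists_smul_eq_of_herm_eq_zero hb hvv hbb (hcon v hv hq))
    obtain ⟨q, hq⟩ := hSne
    have hbS : Projectivization.mk ℂ b hb ∈ S := hSb q hq ▸ hq
    exact not_forall_act_eq hPU hdisc h3 hb hbb
      fun γ => hSb _ (hSinv γ ▸ Set.mem_image_of_mem _ hbS)
  exact hSc.mem_of_tendsto (hact x hx hxb)
    (Eventually.of_forall fun m => hSinv (g m) ▸ Set.mem_image_of_mem _ hxS)
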